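/- Let G be a simple graph on a vertex type V, let i, j, k be three pairwise distinct vertices, and let ℓ ≥ 2 be a natural number. Let G∖k denote the spanning subgraph of G obtained by deleting every edge incident to k, let η := {j} ∪ {u | u ≠ k and G.Adj u j} (the closed neighborhood of j in G∖k), let G∖η denote the spanning subgraph of G obtained by deleting every edge having an endpoint in η, and let G∖j denote the spanning subgraph of G obtained by deleting every edge incident to j. Then the following are equivalent: (A) G.edist i k = ℓ − 1 and G.Adj k j and (G∖k).edist i j ≥ ℓ; (B) either [(G∖j).edist i k = ℓ − 1 and G.Adj k j and (G∖k).edist i j = ⊤], or [(G∖η).edist i k = ℓ − 1 and G.Adj k j and ℓ ≤ (G∖k).edist i j and (G∖k).edist i j < ⊤]. -/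

import Mathlib

open SimpleGraph

/-- The spanning subgraph of `G` obtained by deleting every edge having an endpoint
in the vertex set `S`. -/
def SimpleGraph.deleteEdgesOn {V : Type*} (G : SimpleGraph V) (S : Set V) : SimpleGraph V where
  Adj u v := G.Adj u v ∧ u ∉ S ∧ v ∉ S
  symm := ⟨fun u v h => ⟨h.1.symm, h.2.2, h.2.1⟩⟩
  loopless := ⟨fun u h => G.loopless.irrefl u h.1⟩

theorem pbe_walk {V : Type*} (G : SimpleGraph V) (j k : V) (hjk : j ≠ k) {i c : V}
    (p : G.Walk i c) (hc : c = k)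
    (hp : (p.length : ℕ∞) < (G.deleteEdgesOn {k}).edist i j) :
    (G.deleteEdgesOn ({j} ∪ {u | u ≠ k ∧ G.Adj u j})).edist i k ≤ (p.length : ℕ∞) ∧
      i ∉ ({j} ∪ {u | u ≠ k ∧ G.Adj u j} : Set V) := by
  induction p with
  | nil =>
    subst hc
    refine ⟨by simp, ?_⟩
    simp [hjk.symm]
  | @cons a b d h p ih =>
    by_cases hak : a = k
    · subst hak
      refine ⟨by simp, ?_⟩
      simp [hjk.symm]
    have ha : a ∉ ({j} ∪ {u | u ≠ k ∧ G.Adj u j} : Set V) := by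
      rintro (h1 | ⟨-, h1⟩)
      · rw [Set.mem_singleton_iff] at h1
        subst h1
        simp at hp
      · have h2 : (G.deleteEdgesOn {k}).Adj a j := ⟨h1, by simpa using hak, by simpa using hjk⟩
        rw [edist_eq_one_iff_adj.2 h2] at hp
        simp at hp
    have key : b ∉ ({j} ∪ {u | u ≠ k ∧ G.Adj u j} : Set V) ∧
        (G.deleteEdgesOn ({j} ∪ {u | u ≠ k ∧ G.Adj u j})).edist b k ≤ (p.length : ℕ∞) := by
      by_cases hbk : b = k
      · subst hbk
        exact ⟨by simp [hjk.symm], by simp⟩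
      · have h2 : (G.deleteEdgesOn {k}).Adj a b := ⟨h, by simpa using hak, by simpa using hbk⟩
        have h3 := (G.deleteEdgesOn {k}).edist_triangle (u := a) (v := b) (w := j)
        rw [edist_eq_one_iff_adj.2 h2] at h3
        have h4 := lt_of_lt_of_le hp h3
        rw [Walk.length_cons, Nat.cast_add, Nat.cast_one, add_comm] at h4
        have h5 := ih hc (lt_of_add_lt_add_left h4)
        exact ⟨h5.2, h5.1⟩
    refine ⟨?_, ha⟩
    have h2 : (G.deleteEdgesOn ({j} ∪ {u | u ≠ k ∧ G.Adj u j})).Adj a b := ⟨h, ha, key.1⟩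
    have h3 := (G.deleteEdgesOn ({j} ∪ {u | u ≠ k ∧ G.Adj u j})).edist_triangle
      (u := a) (v := b) (w := k)
    rw [edist_eq_one_iff_adj.2 h2] at h3
    refine h3.trans ?_
    rw [Walk.length_cons, Nat.cast_add, Nat.cast_one, add_comm]
    gcongr
    exact key.2

theorem pbe_le {V : Type*} (G : SimpleGraph V) (i j k : V) (hjk : j ≠ k)
    (hp : G.edist i k < (G.deleteEdgesOn {k}).edist i j) :
    (G.deleteEdgesOn ({j} ∪ {u | u ≠ k ∧ G.Adj u j})).edist i k ≤ G.edist i k := by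
  obtain ⟨p, hpl⟩ := exists_walk_of_edist_ne_top (ne_top_of_lt hp)
  rw [← hpl] at hp ⊢
  exact (pbe_walk G j k hjk p rfl hp).1

/-- The combinatorial equivalence at the core of the penultimate bridging probability lemma
(Eq. `lemma1_equivalence`). -/
theorem penultimate_bridging_equivalence {V : Type*} (G : SimpleGraph V) (i j k : V)
    (hij : i ≠ j) (hik : i ≠ k) (hjk : j ≠ k) (ℓ : ℕ) (hℓ : 2 ≤ ℓ) :
    let Gk := G.deleteEdgesOn {k}
    let η : Set V := {j} ∪ {u | u ≠ k ∧ G.Adj u j}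
    let Gη := G.deleteEdgesOn η
    let Gj := G.deleteEdgesOn {j}
    (G.edist i k = ((ℓ - 1 : ℕ) : ℕ∞) ∧ G.Adj k j ∧ (ℓ : ℕ∞) ≤ Gk.edist i j) ↔
      ((Gj.edist i k = ((ℓ - 1 : ℕ) : ℕ∞) ∧ G.Adj k j ∧ Gk.edist i j = ⊤) ∨
        (Gη.edist i k = ((ℓ - 1 : ℕ) : ℕ∞) ∧ G.Adj k j ∧
          (ℓ : ℕ∞) ≤ Gk.edist i j ∧ Gk.edist i j < ⊤)) := by
  intro Gk η Gη Gj
  have h1 : G.edist i k ≤ Gj.edist i k := edist_anti (fun a b h => h.1)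
  have h2 : Gj.edist i k ≤ Gη.edist i k := edist_anti
    (fun a b h => ⟨h.1, fun h' => h.2.1 (Or.inl h'), fun h' => h.2.2 (Or.inl h')⟩)
  have h3 : G.edist i k < Gk.edist i j → Gη.edist i k ≤ G.edist i k := pbe_le G i j k hjk
  have hl : ((ℓ - 1 : ℕ) : ℕ∞) < (ℓ : ℕ∞) := by
    exact_mod_cast (by omega : ℓ - 1 < ℓ)
  constructor
  · rintro ⟨ha, hb, hc⟩
    have h4 := h3 (ha ▸ hl.trans_le hc)
    by_cases ht : Gk.edist i j = ⊤
    · exact Or.inl ⟨le_antisymm (ha ▸ h2.trans h4) (ha ▸ h1), hb, ht⟩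
    · exact Or.inr ⟨le_antisymm (ha ▸ h4) (ha ▸ h1.trans h2), hb, hc, lt_top_iff_ne_top.2 ht⟩
  · rintro (⟨ha, hb, hc⟩ | ⟨ha, hb, hc, -⟩)
    · have h4 := h3 (by rw [hc]; exact h1.trans_lt (ha ▸ ENat.coe_lt_top _))
      exact ⟨le_antisymm (ha ▸ h1) (ha ▸ h2.trans h4), hb, hc ▸ le_top⟩
    · have h4 := h3 (((h1.trans h2).trans_eq ha).trans_lt (hl.trans_le hc))
      exact ⟨le_antisymm (ha ▸ h1.trans h2) (ha ▸ h4), hb, hc⟩
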